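/- The sequence (1,49,81,79,81) is a nonunimodal pure O-sequence of socle degree 4: it equals (1,5,15,35,70) + 11·(0,4,6,4,1), a sum of one truncated polynomial-ring pure O-sequence and eleven copies of the complete-intersection pure O-sequence (1,4,6,4,1) realized in disjoint variables. -/

import Mathlib

open scoped Classical

/-- total degree of a monomial, recorded as an exponent vector -/
def mdeg {r : ℕ} (m : Fin r → ℕ) : ℕ := ∑ i, m i

/-- a monomial order ideal: a finite nonempty set of monomials closed under divisibility -/
def IsOrderIdeal {r : ℕ} (X : Finset (Fin r → ℕ)) : Prop :=
  X.Nonempty ∧ ∀ m ∈ X, ∀ m' : Fin r → ℕ, m' ≤ m → m' ∈ X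

/-- the maximal monomials of `X` under divisibility -/
noncomputable def maxMons {r : ℕ} (X : Finset (Fin r → ℕ)) : Finset (Fin r → ℕ) :=
  X.filter fun m => ∀ m' ∈ X, m ≤ m' → m' = m

/-- `X` is pure of socle degree `e`: all maximal monomials have degree `e` -/
def IsPure {r : ℕ} (X : Finset (Fin r → ℕ)) (e : ℕ) : Prop :=
  ∀ m ∈ maxMons X, mdeg m = e

/-- the `h`-vector of `X`: the number of monomials of each degree -/
noncomputable def hVec {r : ℕ} (X : Finset (Fin r → ℕ)) (i : ℕ) : ℕ :=
  (X.filter fun m => mdeg m = i).card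

/-- a finite list is a pure `O`-sequence if it is the `h`-vector of a pure monomial
order ideal (of socle degree `length - 1`) -/
def IsPureOSeqList (h : List ℕ) : Prop :=
  ∃ (r : ℕ) (X : Finset (Fin r → ℕ)), IsOrderIdeal X ∧ IsPure X (h.length - 1) ∧
    ∀ i, hVec X i = h.getD i 0

/-- a finite list is unimodal if it has no strict interior valley -/
def UnimodalList (l : List ℕ) : Prop :=
  ∀ i j k, i ≤ j → j ≤ k → k < l.length → min (l.getD i 0) (l.getD k 0) ≤ l.getD j 0

/-- `h` is the `h`-vector of a pure monomial order ideal of socle degree `e`. -/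
def IsPureOSeq (h : ℕ → ℕ) (e : ℕ) : Prop :=
  ∃ (r : ℕ) (X : Finset (Fin r → ℕ)), IsOrderIdeal X ∧ IsPure X e ∧ ∀ i, hVec X i = h i

lemma mdeg_append {r s : ℕ} (a : Fin r → ℕ) (b : Fin s → ℕ) :
    mdeg (Fin.append a b) = mdeg a + mdeg b := by
  simp [mdeg, Fin.sum_univ_add]

lemma mdeg_zero {r : ℕ} : mdeg (0 : Fin r → ℕ) = 0 := by
  simp [mdeg]

lemma mdeg_eq_zero_iff {r : ℕ} {m : Fin r → ℕ} : mdeg m = 0 ↔ m = 0 := by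
  simp [mdeg, funext_iff]

lemma IsOrderIdeal.zero_mem {r : ℕ} {X : Finset (Fin r → ℕ)} (hX : IsOrderIdeal X) : 0 ∈ X := by
  obtain ⟨m, hm⟩ := hX.1
  exact hX.2 m hm 0 zero_le

lemma IsOrderIdeal.hVec_zero {r : ℕ} {X : Finset (Fin r → ℕ)} (hX : IsOrderIdeal X) :
    hVec X 0 = 1 := by
  rw [hVec, Finset.card_eq_one]
  refine ⟨0, ?_⟩
  ext m
  simp only [Finset.mem_filter, Finset.mem_singleton, mdeg_eq_zero_iff]
  exact ⟨fun h => h.2, fun h => ⟨h ▸ hX.zero_mem, h⟩⟩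

lemma append_le_append_iff {r s : ℕ} {a a' : Fin r → ℕ} {b b' : Fin s → ℕ} :
    Fin.append a b ≤ Fin.append a' b' ↔ a ≤ a' ∧ b ≤ b' := by
  simp [Pi.le_def, Fin.forall_fin_add]

lemma append_inj_iff {r s : ℕ} {a a' : Fin r → ℕ} {b b' : Fin s → ℕ} :
    Fin.append a b = Fin.append a' b' ↔ a = a' ∧ b = b' := by
  simp [funext_iff, Fin.forall_fin_add]

/-- The union of two monomial sets, realized in disjoint variables. -/
noncomputable def disjointUnion {r s : ℕ} (X : Finset (Fin r → ℕ)) (Y : Finset (Fin s → ℕ)) :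
    Finset (Fin (r + s) → ℕ) :=
  X.image (fun a => Fin.append a 0) ∪ Y.image (fun b => Fin.append 0 b)

lemma append_mem_disjointUnion {r s : ℕ} {X : Finset (Fin r → ℕ)} {Y : Finset (Fin s → ℕ)}
    {a : Fin r → ℕ} {b : Fin s → ℕ} :
    Fin.append a b ∈ disjointUnion X Y ↔ (a ∈ X ∧ b = 0) ∨ (a = 0 ∧ b ∈ Y) := by
  simp only [disjointUnion, Finset.mem_union, Finset.mem_image, append_inj_iff]
  aesop

lemma exists_eq_append {r s : ℕ} (m : Fin (r + s) → ℕ) :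
    ∃ (a : Fin r → ℕ) (b : Fin s → ℕ), m = Fin.append a b :=
  ⟨_, _, (Fin.append_castAdd_natAdd (f := m)).symm⟩

lemma IsOrderIdeal.disjointUnion {r s : ℕ} {X : Finset (Fin r → ℕ)} {Y : Finset (Fin s → ℕ)}
    (hX : IsOrderIdeal X) (hY : IsOrderIdeal Y) : IsOrderIdeal (disjointUnion X Y) := by
  refine ⟨⟨Fin.append 0 0, append_mem_disjointUnion.2 (Or.inl ⟨hX.zero_mem, rfl⟩)⟩, ?_⟩
  intro m hm m' hle
  obtain ⟨a, b, rfl⟩ := exists_eq_append m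
  obtain ⟨a', b', rfl⟩ := exists_eq_append m'
  rw [append_le_append_iff] at hle
  rw [append_mem_disjointUnion] at hm ⊢
  rcases hm with ⟨ha, rfl⟩ | ⟨rfl, hb⟩
  · exact Or.inl ⟨hX.2 a ha a' hle.1, le_antisymm hle.2 zero_le⟩
  · exact Or.inr ⟨le_antisymm hle.1 zero_le, hY.2 b hb b' hle.2⟩

lemma IsPure.disjointUnion {r s e : ℕ} {X : Finset (Fin r → ℕ)} {Y : Finset (Fin s → ℕ)}
    (hX : IsPure X e) (hY : IsPure Y e) : IsPure (disjointUnion X Y) e := by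
  intro m hm
  obtain ⟨a, b, rfl⟩ := exists_eq_append m
  obtain ⟨hm, hmax⟩ := Finset.mem_filter.1 hm
  rw [mdeg_append]
  rcases append_mem_disjointUnion.1 hm with ⟨ha, rfl⟩ | ⟨rfl, hb⟩
  · rw [mdeg_zero, add_zero]
    refine hX a (Finset.mem_filter.2 ⟨ha, fun a' ha' hle => ?_⟩)
    exact (append_inj_iff.1 (hmax (Fin.append a' 0)
      (append_mem_disjointUnion.2 (Or.inl ⟨ha', rfl⟩)) (append_le_append_iff.2 ⟨hle, le_rfl⟩))).1
  · rw [mdeg_zero, zero_add]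
    refine hY b (Finset.mem_filter.2 ⟨hb, fun b' hb' hle => ?_⟩)
    exact (append_inj_iff.1 (hmax (Fin.append 0 b')
      (append_mem_disjointUnion.2 (Or.inr ⟨rfl, hb'⟩)) (append_le_append_iff.2 ⟨le_rfl, hle⟩))).2

lemma hVec_disjointUnion {r s i : ℕ} (X : Finset (Fin r → ℕ)) (Y : Finset (Fin s → ℕ))
    (hi : i ≠ 0) : hVec (disjointUnion X Y) i = hVec X i + hVec Y i := by
  rw [hVec, disjointUnion, Finset.filter_union, Finset.card_union_of_disjoint]
  · congr 1
    · rw [Finset.filter_image, Finset.card_image_of_injective _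
        fun a a' h => (append_inj_iff.1 h).1]
      simp [hVec, mdeg_append, mdeg_zero]
    · rw [Finset.filter_image, Finset.card_image_of_injective _
        fun b b' h => (append_inj_iff.1 h).2]
      simp [hVec, mdeg_append, mdeg_zero]
  · rw [Finset.disjoint_left]
    intro m hm hm'
    simp only [Finset.mem_filter, Finset.mem_image] at hm hm'
    obtain ⟨⟨a, -, rfl⟩, hdeg⟩ := hm
    obtain ⟨⟨b, -, hb⟩, -⟩ := hm'
    obtain ⟨rfl, rfl⟩ := append_inj_iff.1 hb
    rw [mdeg_append, mdeg_zero, mdeg_zero] at hdeg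
    exact hi hdeg.symm

/-- Pure `O`-sequences of the same socle degree add in positive degrees. -/
lemma IsPureOSeq.add {h h' : ℕ → ℕ} {e : ℕ} (hh : IsPureOSeq h e) (hh' : IsPureOSeq h' e) :
    IsPureOSeq (fun i => if i = 0 then 1 else h i + h' i) e := by
  obtain ⟨r, X, hX, hXp, hXh⟩ := hh
  obtain ⟨s, Y, hY, hYp, hYh⟩ := hh'
  refine ⟨r + s, disjointUnion X Y, hX.disjointUnion hY, hXp.disjointUnion hYp, fun i => ?_⟩
  dsimp only
  split_ifs with hi
  · rw [hi, (hX.disjointUnion hY).hVec_zero]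
  · rw [hVec_disjointUnion X Y hi, hXh, hYh]

lemma IsPureOSeq.add_mul {h h' : ℕ → ℕ} {e : ℕ} (hh : IsPureOSeq h e) (hh' : IsPureOSeq h' e)
    (n : ℕ) : IsPureOSeq (fun i => if i = 0 then 1 else h i + n * h' i) e := by
  induction n with
  | zero =>
    obtain ⟨r, X, hX, hXp, hXh⟩ := hh
    refine ⟨r, X, hX, hXp, fun i => ?_⟩
    dsimp only
    split_ifs with hi
    · rw [hi, hX.hVec_zero]
    · simp [hXh]
  | succ n ih =>
    convert ih.add hh' using 2 with i
    split_ifs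
    · rfl
    · ring

/-- The monomials of degree at most `e` in `r + 1` variables form a pure order ideal. -/
lemma isPureOSeq_truncated (r e : ℕ) :
    IsPureOSeq (fun i => if i ≤ e then (r + i).choose i else 0) e := by
  have mem : ∀ m : Fin (r + 1) → ℕ,
      m ∈ (Finset.range (e + 1)).biUnion (Finset.piAntidiag Finset.univ) ↔ mdeg m ≤ e := by
    intro m
    simp [mdeg]
  refine ⟨r + 1, (Finset.range (e + 1)).biUnion (Finset.piAntidiag Finset.univ),
    ⟨⟨0, (mem 0).2 (by simp [mdeg_zero])⟩, fun m hm m' hle => ?_⟩, fun m hm => ?_, fun i => ?_⟩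
  · rw [mem] at hm ⊢
    exact (Finset.sum_le_sum fun i _ => hle i).trans hm
  · obtain ⟨hm, hmax⟩ := Finset.mem_filter.1 hm
    rw [mem] at hm
    by_contra hne
    have hdeg : mdeg (m + Pi.single 0 1) = mdeg m + 1 := by
      simp [mdeg, Finset.sum_add_distrib]
    have heq := hmax (m + Pi.single 0 1) ((mem _).2 (by omega)) le_self_add
    rw [heq] at hdeg
    omega
  · rw [hVec]
    dsimp only
    split_ifs with hi
    · have hfil : ((Finset.range (e + 1)).biUnion (Finset.piAntidiag Finset.univ)).filter
          (fun m : Fin (r + 1) → ℕ => mdeg m = i) = Finset.piAntidiag Finset.univ i := by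
        ext m
        rw [Finset.mem_filter, mem]
        simp only [Finset.mem_piAntidiag, mdeg, Finset.mem_univ, implies_true, and_true]
        exact ⟨fun h => h.2, fun h => ⟨h.le.trans hi, h⟩⟩
      rw [hfil]
      have hcard := Finset.card_finsuppAntidiag_nat_eq_choose
        (s := (Finset.univ : Finset (Fin (r + 1)))) i
      rw [Finset.finsuppAntidiag, Finset.card_map, Finset.card_attach, Finset.card_univ,
        Fintype.card_fin, add_right_comm, Nat.add_sub_cancel] at hcard
      convert hcard
    · rw [Finset.card_eq_zero, Finset.filter_eq_empty_iff]
      intro m hm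
      rw [mem] at hm
      omega

/-- The squarefree monomials in `r` variables form a pure order ideal with one generator. -/
lemma isPureOSeq_squarefree (r : ℕ) : IsPureOSeq (fun i => r.choose i) r := by
  refine ⟨r, Finset.Iic 1, ⟨⟨0, by simp⟩, fun m hm m' hle => ?_⟩, fun m hm => ?_, fun i => ?_⟩
  · rw [Finset.mem_Iic] at hm ⊢
    exact hle.trans hm
  · obtain ⟨hm, hmax⟩ := Finset.mem_filter.1 hm
    rw [← hmax 1 (by simp) (Finset.mem_Iic.1 hm)]
    simp [mdeg]
  · have himg : (Finset.Iic (1 : Fin r → ℕ)).filter (fun m => mdeg m = i) =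
        (Finset.univ.powersetCard i).image
          (fun s : Finset (Fin r) => fun j => if j ∈ s then 1 else 0) := by
      ext m
      simp only [Finset.mem_filter, Finset.mem_Iic, Finset.mem_image, Finset.mem_powersetCard,
        Finset.subset_univ, true_and]
      constructor
      · rintro ⟨hm, hdeg⟩
        have hval : (fun j => if j ∈ Finset.univ.filter (fun j => m j = 1) then 1 else 0) = m := by
          funext j
          have := hm j
          simp only [Pi.one_apply] at this
          simp only [Finset.mem_filter, Finset.mem_univ, true_and]
          split_ifs <;> omega
        refine ⟨Finset.univ.filter (fun j => m j = 1), ?_, hval⟩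
        rw [← hdeg, ← hval]
        simp [mdeg]
      · rintro ⟨s, hs, rfl⟩
        refine ⟨fun j => ?_, by simp [mdeg, hs]⟩
        simp only [Pi.one_apply]
        split_ifs <;> simp
    rw [hVec, himg, Finset.card_image_of_injective, Finset.card_powersetCard, Finset.card_univ,
      Fintype.card_fin]
    intro s t hst
    ext j
    have := congrFun hst j
    by_cases h1 : j ∈ s <;> by_cases h2 : j ∈ t <;> simp_all

/-- `(1,49,81,79,81) = (1,5,15,35,70) + 11·(0,4,6,4,1)` is a nonunimodal pure
`O`-sequence of socle degree `4`. -/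
theorem stmt11 :
    [1, 49, 81, 79, 81] =
      List.zipWith (fun x y => x + 11 * y) [1, 5, 15, 35, 70] [0, 4, 6, 4, 1] ∧
    IsPureOSeqList [1, 49, 81, 79, 81] ∧
    ¬ UnimodalList [1, 49, 81, 79, 81] := by
  refine ⟨rfl, ?_, fun h => absurd (h 2 3 4 (by simp) (by simp) (by simp)) (by simp)⟩
  obtain ⟨r, X, hX, hXp, hXh⟩ := (isPureOSeq_truncated 4 4).add_mul (isPureOSeq_squarefree 4) 11
  refine ⟨r, X, hX, hXp, fun i => (hXh i).trans ?_⟩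
  rcases lt_or_ge i 5 with hi | hi
  · interval_cases i <;> decide
  · dsimp only
    rw [if_neg (by omega), if_neg (by omega), Nat.choose_eq_zero_of_lt (by omega),
      List.getD_eq_default _ _ (by simpa using hi)]
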